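/- For every x ∈ ℝ, |R₀'(x)| < 0.52. -/

import Mathlib

open Real MeasureTheory intervalIntegral

noncomputable section

/-- The Fourier coefficients `c_k` of the approximate solution. -/
def coefC : ℕ → ℝ
  | 0 => 1
  | 1 => 6.990356082734282e-2
  | 2 => 1.481485591846559e-2
  | 3 => 4.562581793349477e-3
  | 4 => 1.662067385043346e-3
  | 5 => 6.660065136771192e-4
  | 6 => 2.837414439454572e-4
  | 7 => 1.261501302020939e-4
  | 8 => 5.787204471053671e-5
  | 9 => 2.719406328587438e-5
  | 10 => 1.302302594759571e-5
  | 11 => 6.333059955650702e-6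
  | 12 => 3.119022088447539e-6
  | 13 => 1.552543629347692e-6
  | 14 => 7.798356164400106e-7
  | 15 => 3.947768555872326e-7
  | 16 => 2.012104965444521e-7
  | 17 => 1.031670056456975e-7
  | 18 => 5.317712460135162e-8
  | 19 => 2.753934675108659e-8
  | 20 => 1.432242380745116e-8
  | 21 => 7.477109926654982e-9
  | 22 => 3.916974811811910e-9
  | 23 => 2.058418356388450e-9
  | 24 => 1.084839772995918e-9
  | 25 => 5.732502021897411e-10
  | 26 => 3.036541152512813e-10
  | 27 => 1.612094123238438e-10
  | 28 => 8.576430342713042e-11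
  | 29 => 4.571554686889860e-11
  | 30 => 2.441210348018661e-11
  | _ => 0

/-- The approximate solution `R₀(x) = ∑_{k=0}^{30} c_k cos(6 k x)`. -/
def R0 (x : ℝ) : ℝ := ∑ k ∈ Finset.range 31, coefC k * Real.cos (6 * k * x)

lemma deriv_R0_eq (x : ℝ) :
    deriv R0 x = -∑ k ∈ Finset.range 31, 6 * k * coefC k * Real.sin (k * (6 * x)) := by
  have h : ∀ k ∈ Finset.range 31, HasDerivAt (fun x : ℝ => coefC k * Real.cos (6 * k * x))
      (-(6 * k * coefC k * Real.sin (k * (6 * x)))) x := by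
    intro k _
    have h1 : HasDerivAt (fun x : ℝ => 6 * (k : ℝ) * x) (6 * k) x := by
      simpa using (hasDerivAt_id x).const_mul (6 * (k : ℝ))
    have h2 := (h1.cos).const_mul (coefC k)
    refine h2.congr_deriv ?_
    rw [show 6 * (k : ℝ) * x = k * (6 * x) by ring]
    ring
  have h3 := HasDerivAt.fun_sum h
  have h4 : deriv R0 x = _ := h3.deriv
  rw [h4, Finset.sum_neg_distrib]

lemma bern_nonneg (l h t : ℝ) (hl : l ≤ t) (hh : t ≤ h) (i j : ℕ) :
    0 ≤ (h - t) ^ i * (t - l) ^ j :=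
  mul_nonneg (pow_nonneg (by linarith) _) (pow_nonneg (by linarith) _)

lemma poly_left (t : ℝ) (h1 : -1 ≤ t) (h2 : t ≤ 4 / 5) :
    (35197/100000 + 11751/50000*t + 5399/25000*t^2 + 537/2500*t^3 - 326/3125*t^4 - 647/3125*t^5 + 212/625*t^6 + 1112/3125*t^7) * (1 + (29/40)^2 - t^2) ≤ 0.5167 * (2 * (29/40)) := by
  have hB := bern_nonneg _ _ t h1 h2
  linarith [hB 9 0, hB 8 1, hB 7 2, hB 6 3, hB 5 4, hB 4 5, hB 3 6, hB 2 7, hB 1 8, hB 0 9]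

lemma poly_right (t : ℝ) (h1 : 4 / 5 ≤ t) (h2 : t ≤ 1) :
    (35197/100000 + 11751/50000*t + 5399/25000*t^2 + 537/2500*t^3 - 326/3125*t^4 - 647/3125*t^5 + 212/625*t^6 + 1112/3125*t^7) * (1 + (1/2)^2 - t^2) ≤ 0.5167 * (2 * (1/2)) := by
  have hB := bern_nonneg _ _ t h1 h2
  linarith [hB 9 0, hB 8 1, hB 7 2, hB 6 3, hB 5 4, hB 4 5, hB 3 6, hB 2 7, hB 1 8, hB 0 9]

lemma poly_lower (t : ℝ) (h1 : -1 ≤ t) (h2 : t ≤ 1) :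
    -0.3 ≤ (35197/100000 + 11751/50000*t + 5399/25000*t^2 + 537/2500*t^3 - 326/3125*t^4 - 647/3125*t^5 + 212/625*t^6 + 1112/3125*t^7) := by
  have hB := bern_nonneg _ _ t h1 h2
  linarith [hB 7 0, hB 6 1, hB 5 2, hB 4 3, hB 3 4, hB 2 5, hB 1 6, hB 0 7]

lemma main_bound (s t : ℝ) (hs : 0 ≤ s) (hst : s ^ 2 + t ^ 2 = 1) :
    s * |(35197/100000 + 11751/50000*t + 5399/25000*t^2 + 537/2500*t^3 - 326/3125*t^4 - 647/3125*t^5 + 212/625*t^6 + 1112/3125*t^7)| ≤ 0.5167 := by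
  have ht1 : -1 ≤ t := by nlinarith [sq_nonneg s]
  have ht2 : t ≤ 1 := by nlinarith [sq_nonneg s]
  have hs1 : s ≤ 1 := by nlinarith [sq_nonneg t]
  have hlow := poly_lower t ht1 ht2
  have hleft := poly_left t ht1
  have hright := fun h => poly_right t h ht2
  generalize (35197/100000 + 11751/50000*t + 5399/25000*t^2 + 537/2500*t^3 - 326/3125*t^4 - 647/3125*t^5 + 212/625*t^6 + 1112/3125*t^7) = p at *
  rcases le_total p 0 with hp | hp
  · rw [abs_of_nonpos hp]
    nlinarith
  · rw [abs_of_nonneg hp]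
    rcases le_total t (4 / 5) with h | h
    · nlinarith [hleft h, mul_nonneg hp (sq_nonneg (s - 29/40))]
    · nlinarith [hright h, mul_nonneg hp (sq_nonneg (s - 1/2))]

lemma sin_rec (n : ℕ) (y : ℝ) :
    Real.sin (((n + 2 : ℕ) : ℝ) * y)
      = 2 * Real.cos y * Real.sin (((n + 1 : ℕ) : ℝ) * y) - Real.sin ((n : ℝ) * y) := by
  have e1 : ((n + 2 : ℕ) : ℝ) * y = ((n + 1 : ℕ) : ℝ) * y + y := by push_cast; ring
  have e2 : (n : ℝ) * y = ((n + 1 : ℕ) : ℝ) * y - y := by push_cast; ring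
  rw [e1, e2, Real.sin_add, Real.sin_sub]
  ring

lemma head_eq (f : ℕ → ℝ) (s t : ℝ) (h0 : f 0 = 0) (h1 : f 1 = s)
    (hr : ∀ n, f (n + 2) = 2 * t * f (n + 1) - f n) :
    0.41942 * f 1 + 0.17778 * f 2 + 0.08213 * f 3 + 0.03989 * f 4 + 0.01998 * f 5
      + 0.01021 * f 6 + 0.0053 * f 7 + 0.00278 * f 8 = s * (35197/100000 + 11751/50000*t + 5399/25000*t^2 + 537/2500*t^3 - 326/3125*t^4 - 647/3125*t^5 + 212/625*t^6 + 1112/3125*t^7) := by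
  simp only [hr 6, hr 5, hr 4, hr 3, hr 2, hr 1, hr 0, h0, h1, Nat.reduceAdd, zero_add]
  ring

/-- Lemma 2.3: `|R₀'(x)| < 0.52` for every `x`. -/
theorem stmt_4 : ∀ x : ℝ, |deriv R0 x| < 0.52 := by
  intro x
  rw [deriv_R0_eq, abs_neg]
  set f : ℕ → ℝ := fun k => Real.sin (k * (6 * x)) with hf
  have hr : ∀ n, f (n + 2) = 2 * Real.cos (6 * x) * f (n + 1) - f n :=
    fun n => sin_rec n (6 * x)
  have hhead := head_eq f (Real.sin (6 * x)) (Real.cos (6 * x)) (by simp [hf]) (by simp [hf]) hr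
  have hm := main_bound |Real.sin (6 * x)| (Real.cos (6 * x)) (abs_nonneg _)
    (by rw [sq_abs]; exact Real.sin_sq_add_cos_sq _)
  rw [← abs_mul, ← hhead] at hm
  have hup : ∀ n, f n ≤ 1 := fun n => Real.sin_le_one _
  have hlo : ∀ n, -1 ≤ f n := fun n => Real.neg_one_le_sin _
  have hsum : ∑ k ∈ Finset.range 31, 6 * k * coefC k * Real.sin (k * (6 * x))
      = ∑ k ∈ Finset.range 31, 6 * k * coefC k * f k := rfl
  rw [hsum]
  clear_value f
  clear hf hsum hhead hr
  obtain ⟨hm1, hm2⟩ := abs_le.mp hm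
  simp only [Finset.sum_range_succ, Finset.sum_range_zero, coefC]
  push_cast
  rw [abs_lt]
  constructor
  · linarith [hup 1, hlo 1, hup 2, hlo 2, hup 3, hlo 3, hup 4, hlo 4, hup 5, hlo 5, hup 6, hlo 6, hup 7, hlo 7, hup 8, hlo 8, hup 9, hlo 9, hup 10, hlo 10, hup 11, hlo 11, hup 12, hlo 12, hup 13, hlo 13, hup 14, hlo 14, hup 15, hlo 15, hup 16, hlo 16, hup 17, hlo 17, hup 18, hlo 18, hup 19, hlo 19, hup 20, hlo 20, hup 21, hlo 21, hup 22, hlo 22, hup 23, hlo 23, hup 24, hlo 24, hup 25, hlo 25, hup 26, hlo 26, hup 27, hlo 27, hup 28, hlo 28, hup 29, hlo 29, hup 30, hlo 30]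
  · linarith [hup 1, hlo 1, hup 2, hlo 2, hup 3, hlo 3, hup 4, hlo 4, hup 5, hlo 5, hup 6, hlo 6, hup 7, hlo 7, hup 8, hlo 8, hup 9, hlo 9, hup 10, hlo 10, hup 11, hlo 11, hup 12, hlo 12, hup 13, hlo 13, hup 14, hlo 14, hup 15, hlo 15, hup 16, hlo 16, hup 17, hlo 17, hup 18, hlo 18, hup 19, hlo 19, hup 20, hlo 20, hup 21, hlo 21, hup 22, hlo 22, hup 23, hlo 23, hup 24, hlo 24, hup 25, hlo 25, hup 26, hlo 26, hup 27, hlo 27, hup 28, hlo 28, hup 29, hlo 29, hup 30, hlo 30]
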